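/- Let R be the fusion ring of Rep(D₈) with dimension homomorphism d and differential δ, and let n_D be the ℤ-bilinear map R × R → ℤ with n_D(e_D, e_D) = 1 and n_D(x, y) = 0 for every other pair (x, y) of basis elements. Then δ n_D = 0, and for an integer c the cochain c·n_D is a 2-coboundary (i.e. of the form δl for some ℤ-linear l : R → ℤ) if and only if 4 divides c. Consequently the class of n_D in H² = ker(δ on C²)/im(δ from C¹) has order exactly 4. -/

import Mathlib

noncomputable section

namespace RepD8Fusion

/-- Index of the basis of the fusion ring of `Rep(D₈)`: the four invertible simple
objects labelled by `ℤ/2 × ℤ/2` and the two-dimensional simple object `D`. -/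
inductive Bas : Type
  | inv : ZMod 2 × ZMod 2 → Bas
  | D : Bas
  deriving DecidableEq

/-- The fusion ring of `Rep(D₈)` as a free ℤ-module on the five simple objects. -/
abbrev R : Type := Bas →₀ ℤ

/-- The basis element `e_a` for `a ∈ ℤ/2 × ℤ/2`. -/
def e (a : ZMod 2 × ZMod 2) : R := Finsupp.single (Bas.inv a) 1

/-- The basis element `e_D`. -/
def eD : R := Finsupp.single Bas.D 1

/-- Multiplication on basis elements (the fusion rules of `Rep(D₈)`):
`e_a·e_b = e_{a+b}`, `e_a·e_D = e_D·e_a = e_D`, `e_D·e_D = Σ_a e_a`. -/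
def mulB : Bas → Bas → R
  | Bas.inv a, Bas.inv b => e (a + b)
  | Bas.inv _, Bas.D => eD
  | Bas.D, Bas.inv _ => eD
  | Bas.D, Bas.D => ∑ a : ZMod 2 × ZMod 2, e a

/-- The ℤ-bilinear multiplication of the fusion ring, extending the fusion rules. -/
def mul : R →ₗ[ℤ] R →ₗ[ℤ] R :=
  Finsupp.linearCombination ℤ (fun x => Finsupp.linearCombination ℤ (fun y => mulB x y))

/-- Dimensions of the simple objects: `d(e_a) = 1`, `d(e_D) = 2`. -/
def dB : Bas → ℤ
  | Bas.inv _ => 1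
  | Bas.D => 2

/-- The dimension homomorphism `d : R → ℤ` (as a ℤ-linear map; it is the unique ring
homomorphism with `d(e_a) = 1` and `d(e_D) = 2`). -/
def dim : R →ₗ[ℤ] ℤ := Finsupp.linearCombination ℤ dB

end RepD8Fusion

namespace RepD8Fusion

/-- The differential `δ₂` on ℤ-bilinear 2-cochains, recorded as an additive group
homomorphism into `ℤ`-valued functions of three variables:
`(δ₂ n)(r₁,r₂,r₃) = d(r₁)n(r₂,r₃) − n(r₁r₂,r₃) + n(r₁,r₂r₃) − n(r₁,r₂)d(r₃)`. -/
def delta2 : (R →ₗ[ℤ] R →ₗ[ℤ] ℤ) →+ (R → R → R → ℤ) where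
  toFun n := fun r₁ r₂ r₃ =>
    dim r₁ * n r₂ r₃ - n (mul r₁ r₂) r₃ + n r₁ (mul r₂ r₃) - n r₁ r₂ * dim r₃
  map_zero' := by
    funext r₁ r₂ r₃; simp
  map_add' n m := by
    funext r₁ r₂ r₃
    simp only [LinearMap.add_apply, Pi.add_apply]
    ring

/-- The differential `δ₁` from ℤ-linear 1-cochains to ℤ-bilinear 2-cochains:
`(δ₁ l)(r,s) = d(r)l(s) − l(rs) + l(r)d(s)`. -/
def delta1 : (R →ₗ[ℤ] ℤ) →+ (R →ₗ[ℤ] R →ₗ[ℤ] ℤ) where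
  toFun l := LinearMap.mk₂ ℤ (fun r s => dim r * l s - l (mul r s) + l r * dim s)
    (by intro r₁ r₂ s; simp only [map_add, LinearMap.add_apply]; ring)
    (by intro c r s
        simp only [map_smul, LinearMap.smul_apply, smul_eq_mul]; ring)
    (by intro r s₁ s₂; simp only [map_add, LinearMap.add_apply]; ring)
    (by intro c r s
        simp only [map_smul, LinearMap.smul_apply, smul_eq_mul]; ring)
  map_zero' := by
    refine LinearMap.ext fun r => LinearMap.ext fun s => ?_
    simp [LinearMap.mk₂_apply]
  map_add' l m := by
    refine LinearMap.ext fun r => LinearMap.ext fun s => ?_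
    simp only [LinearMap.mk₂_apply, LinearMap.add_apply]
    ring

/-- The group of ℤ-bilinear 2-cocycles. -/
def Z2 : AddSubgroup (R →ₗ[ℤ] R →ₗ[ℤ] ℤ) := delta2.ker

/-- The group of ℤ-bilinear 2-coboundaries. -/
def B2 : AddSubgroup (R →ₗ[ℤ] R →ₗ[ℤ] ℤ) := delta1.range

/-- The second cohomology group `H² = ker δ₂ / im δ₁` of the fusion ring of `Rep(D₈)`. -/
abbrev H2 : Type := ↥Z2 ⧸ (B2.addSubgroupOf Z2)

/-- The class in `H²` of a 2-cocycle. -/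
def cls (n : R →ₗ[ℤ] R →ₗ[ℤ] ℤ) (hn : n ∈ Z2) : H2 :=
  QuotientAddGroup.mk (⟨n, hn⟩ : ↥Z2)

end RepD8Fusion

namespace RepD8Fusion

/-- The ℤ-bilinear 2-cochain `n_D` with `n_D(e_D, e_D) = 1` and value `0` on all other
pairs of basis elements: it sends `(x, y)` to (coefficient of `D` in `x`) · (coefficient
of `D` in `y`). -/
def nD : R →ₗ[ℤ] R →ₗ[ℤ] ℤ :=
  (LinearMap.mul ℤ ℤ).compl₁₂ (Finsupp.lapply Bas.D) (Finsupp.lapply Bas.D)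

/-- The coefficient of `D` in a product; equivalently, `δ₁` of this coefficient is `4·n_D`. -/
lemma mul_apply_D (r s : R) :
    mul r s Bas.D = dim r * s Bas.D + r Bas.D * dim s - 4 * (r Bas.D * s Bas.D) := by
  have h : mul.compr₂ (Finsupp.lapply Bas.D) =
      (LinearMap.mul ℤ ℤ).compl₁₂ dim (Finsupp.lapply Bas.D) +
        (LinearMap.mul ℤ ℤ).compl₁₂ (Finsupp.lapply Bas.D) dim - (4 : ℤ) • nD := by
    ext (a | _) (b | _) <;> simp [mul, dim, dB, nD, mulB, e, eD]
  simpa [nD] using LinearMap.congr_fun₂ h r s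

lemma nD_apply (r s : R) : nD r s = r Bas.D * s Bas.D := by
  simp [nD]

lemma mul_e_e (a b : ZMod 2 × ZMod 2) : mul (e a) (e b) = e (a + b) := by
  simp [mul, e, mulB]

lemma mul_eD_eD : mul eD eD = ∑ a : ZMod 2 × ZMod 2, e a := by
  simp [mul, eD, mulB]

lemma dim_e (a : ZMod 2 × ZMod 2) : dim (e a) = 1 := by
  simp [dim, e, dB]

lemma dim_eD : dim eD = 2 := by
  simp [dim, eD, dB]

lemma smul_nD_coboundary_iff (c : ℤ) :
    (∃ l : R →ₗ[ℤ] ℤ, ∀ r s : R,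
      c * nD r s = dim r * l s - l (mul r s) + l r * dim s) ↔ (4 : ℤ) ∣ c := by
  constructor
  · rintro ⟨l, hl⟩
    have hadd (a b : ZMod 2 × ZMod 2) : l (e (a + b)) = l (e a) + l (e b) := by
      have h := hl (e a) (e b)
      simp only [mul_e_e, dim_e, nD_apply] at h
      simp only [e, Finsupp.single_apply, reduceCtorEq, if_false] at h ⊢
      linarith
    have hzero : l (e 0) = 0 := by simpa using hadd 0 0
    have hinv (a : ZMod 2 × ZMod 2) : l (e a) = 0 := by
      have h := hadd a a
      rw [CharTwo.add_self_eq_zero, hzero] at h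
      linarith
    have h := hl eD eD
    rw [mul_eD_eD, dim_eD, map_sum, Finset.sum_eq_zero fun a _ => hinv a, nD_apply] at h
    simp only [eD, Finsupp.single_eq_same] at h
    exact ⟨l (Finsupp.single Bas.D 1), by linarith⟩
  · rintro ⟨m, rfl⟩
    refine ⟨m • Finsupp.lapply Bas.D, fun r s => ?_⟩
    simp only [LinearMap.smul_apply, Finsupp.lapply_apply, smul_eq_mul, mul_apply_D, nD_apply]
    ring

lemma smul_nD_mem_B2_iff (c : ℤ) : c • nD ∈ B2 ↔ (4 : ℤ) ∣ c := by
  rw [← smul_nD_coboundary_iff, B2, AddMonoidHom.mem_range]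
  refine exists_congr fun l => ?_
  rw [eq_comm, LinearMap.ext_iff₂]
  rfl

/-- `n_D` is a 2-cocycle (`δ n_D = 0`), and for `c : ℤ` the cochain
`c·n_D` is a 2-coboundary — i.e. of the form `δl` for a ℤ-linear `l : R → ℤ`, where
`(δl)(r,s) = d(r)l(s) − l(rs) + l(r)d(s)` — if and only if `4 ∣ c`.  Consequently the
class of `n_D` in `H² = ker δ₂ / im δ₁` has order exactly `4`. -/
theorem nD_cocycle_and_coboundary_iff :
    (∀ r₁ r₂ r₃ : R,
      dim r₁ * nD r₂ r₃ - nD (mul r₁ r₂) r₃ + nD r₁ (mul r₂ r₃) - nD r₁ r₂ * dim r₃ = 0) ∧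
    (∀ c : ℤ,
      (∃ l : R →ₗ[ℤ] ℤ, ∀ r s : R,
          c * nD r s = dim r * l s - l (mul r s) + l r * dim s) ↔ (4 : ℤ) ∣ c) ∧
    (∀ hnD : nD ∈ Z2, addOrderOf (cls nD hnD) = 4) := by
  refine ⟨fun r₁ r₂ r₃ => ?_, smul_nD_coboundary_iff, fun hnD => ?_⟩
  · simp only [nD_apply, mul_apply_D]
    ring
  · refine Nat.dvd_right_iff_eq.mp fun k => ?_
    rw [addOrderOf_dvd_iff_nsmul_eq_zero, cls, ← QuotientAddGroup.mk_nsmul,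
      QuotientAddGroup.eq_zero_iff, AddSubgroup.mem_addSubgroupOf]
    have h := smul_nD_mem_B2_iff k
    rw [natCast_zsmul] at h
    exact h.trans (Int.natCast_dvd_natCast (m := 4))

end RepD8Fusion
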